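/- Let q > 1 and set w₀ = q/(q+1), w_n = q^{-(n-1)}(1-q^{-1})/(q+1) for n ≥ 1. Define sequences a(l,·) by: a(0,n) = 1 for all n; a(1,0) = q^{-1/2}, a(1,n) = -q^{1/2} for n ≥ 1; for l ≥ 2: a(l,n) = 0 for 0 ≤ n ≤ l-2, a(l,l-1) = q^{(l-2)/2}√((q+1)/(q-1)), and a(l,n) = -(q-1)q^{(l-2)/2}√((q+1)/(q-1)) for n ≥ l. Then for all l, l' ≥ 0: ∑_{n=0}^∞ a(l,n)·a(l',n)·w_n equals 1 if l = l' and 0 if l ≠ l'. -/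

import Mathlib

noncomputable section

/-- Masses of the double cosets `D_n`. -/
def cosetMass (q : ℝ) (n : ℕ) : ℝ :=
  if n = 0 then q / (q + 1) else q ^ (1 - (n:ℝ)) * (1 - q⁻¹) / (q + 1)

/-- The values `a(l,n)` of the classical vectors `e_l` on the double cosets `D_n`. -/
def cosetVal (q : ℝ) (l n : ℕ) : ℝ :=
  if l = 0 then 1
  else if l = 1 then (if n = 0 then q ^ (-(1/2 : ℝ)) else -(q ^ ((1/2 : ℝ))))
  else if n + 2 ≤ l then 0
  else if n + 1 = l then q ^ (((l:ℝ) - 2) / 2) * Real.sqrt ((q + 1) / (q - 1))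
  else -((q - 1) * q ^ (((l:ℝ) - 2) / 2) * Real.sqrt ((q + 1) / (q - 1)))

/-- The total mass of the double cosets `D_n` with `n > m`. -/
def cosetTailMass (q : ℝ) (m : ℕ) : ℝ := (q ^ m)⁻¹ / (q + 1)

lemma cosetMass_zero (q : ℝ) : cosetMass q 0 = q / (q + 1) := by
  simp [cosetMass]

lemma cosetMass_succ {q : ℝ} (hq : 0 < q) (k : ℕ) :
    cosetMass q (k + 1) = (q ^ k)⁻¹ * (1 - q⁻¹) / (q + 1) := by
  have h : (1 - ((k + 1 : ℕ) : ℝ)) = -(k : ℝ) := by push_cast; ring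
  rw [cosetMass, if_neg k.succ_ne_zero, h, Real.rpow_neg hq.le, Real.rpow_natCast]

lemma hasSum_cosetMass_tail {q : ℝ} (hq : 1 < q) (m : ℕ) :
    HasSum (fun n ↦ cosetMass q (n + (m + 1))) (cosetTailMass q m) := by
  have hq0 : 0 < q := by linarith
  have hne : q - 1 ≠ 0 := (sub_pos.2 hq).ne'
  have hg := (hasSum_geometric_of_lt_one (inv_nonneg.2 hq0.le)
    (inv_lt_one_of_one_lt₀ hq)).mul_right ((q ^ m)⁻¹ * (1 - q⁻¹) / (q + 1))
  convert! hg using 1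
  · funext n
    rw [← add_assoc, cosetMass_succ hq0, pow_add, inv_pow, mul_inv]
    ring
  · rw [cosetTailMass]
    field_simp

/-- Summation against the coset masses of a sequence vanishing below `m` and constant above `m`. -/
lemma hasSum_mul_cosetMass {q : ℝ} (hq : 1 < q) {f : ℕ → ℝ} {m : ℕ} {y : ℝ}
    (hlow : ∀ n < m, f n = 0) (hhigh : ∀ n, m < n → f n = y) :
    HasSum (fun n ↦ f n * cosetMass q n) (f m * cosetMass q m + y * cosetTailMass q m) := by
  rw [← hasSum_nat_add_iff' (m + 1), Finset.sum_range_succ,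
    Finset.sum_eq_zero fun n hn ↦ by rw [hlow n (Finset.mem_range.1 hn), zero_mul],
    zero_add, add_sub_cancel_left]
  refine ((hasSum_cosetMass_tail hq m).mul_left y).congr_fun fun n ↦ ?_
  rw [hhigh _ (by omega)]

lemma cosetVal_eq_zero (q : ℝ) {l n : ℕ} (h : n + 1 < l) : cosetVal q l n = 0 := by
  rw [cosetVal, if_neg (by omega), if_neg (by omega), if_pos (by omega)]

lemma cosetVal_eq_self (q : ℝ) {l n : ℕ} (h : l ≤ n) : cosetVal q l n = cosetVal q l l := by
  rcases l with _ | _ | k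
  · simp [cosetVal]
  · simp [cosetVal, show n ≠ 0 by omega]
  · simp [cosetVal, show ¬ n ≤ k by omega, show n ≠ k + 1 by omega]

lemma hasSum_cosetVal_mul {q : ℝ} (hq : 1 < q) {l l' : ℕ} (h : l' ≤ l) :
    HasSum (fun n ↦ cosetVal q l n * cosetVal q l' n * cosetMass q n)
      (cosetVal q l (l - 1) * cosetVal q l' (l - 1) * cosetMass q (l - 1)
        + cosetVal q l l * cosetVal q l' l' * cosetTailMass q (l - 1)) := by
  refine hasSum_mul_cosetMass hq (f := fun n ↦ cosetVal q l n * cosetVal q l' n)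
    (fun n hn ↦ ?_) fun n hn ↦ ?_
  · simp only [cosetVal_eq_zero q (show n + 1 < l by omega), zero_mul]
  · simp only [cosetVal_eq_self q (show l ≤ n by omega),
      cosetVal_eq_self q (show l' ≤ n by omega)]

/-- The common scalar in the values of `cosetVal q (k + 2)`. -/
def cosetScale (q : ℝ) (k : ℕ) : ℝ :=
  q ^ ((((k + 2 : ℕ) : ℝ) - 2) / 2) * Real.sqrt ((q + 1) / (q - 1))

lemma cosetScale_sq {q : ℝ} (hq : 1 < q) (k : ℕ) :
    cosetScale q k ^ 2 = q ^ k * ((q + 1) / (q - 1)) := by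
  have hq0 : 0 < q := by linarith
  have hnonneg : 0 ≤ (q + 1) / (q - 1) := div_nonneg (by linarith) (by linarith)
  have he : (((k + 2 : ℕ) : ℝ) - 2) / 2 * (2 : ℕ) = k := by push_cast; ring
  rw [cosetScale, mul_pow, Real.sq_sqrt hnonneg, ← Real.rpow_mul_natCast hq0.le, he,
    Real.rpow_natCast]

lemma cosetVal_add_two_pred (q : ℝ) (k : ℕ) :
    cosetVal q (k + 2) (k + 1) = cosetScale q k := by
  simp [cosetVal, cosetScale]

lemma cosetVal_add_two_self (q : ℝ) (k : ℕ) :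
    cosetVal q (k + 2) (k + 2) = -((q - 1) * cosetScale q k) := by
  simp [cosetVal, cosetScale, mul_assoc]

lemma cosetVal_one_zero {q : ℝ} (hq : 0 < q) : cosetVal q 1 0 = (Real.sqrt q)⁻¹ := by
  simp [cosetVal, Real.sqrt_eq_rpow, Real.rpow_neg hq.le]

lemma cosetVal_one_one (q : ℝ) : cosetVal q 1 1 = -Real.sqrt q := by
  simp [cosetVal, Real.sqrt_eq_rpow]

lemma cosetVal_mean_eq_zero {q : ℝ} (hq : 1 < q) (m : ℕ) :
    cosetVal q (m + 1) m * cosetMass q m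
      + cosetVal q (m + 1) (m + 1) * cosetTailMass q m = 0 := by
  have hq0 : 0 < q := by linarith
  rcases m with _ | k
  · have hs : Real.sqrt q ≠ 0 := (Real.sqrt_pos.2 hq0).ne'
    have h2 : Real.sqrt q ^ 2 = q := Real.sq_sqrt hq0.le
    rw [zero_add, cosetVal_one_zero hq0, cosetVal_one_one, cosetMass_zero, cosetTailMass]
    field_simp
    linear_combination -h2
  · rw [cosetVal_add_two_pred, cosetVal_add_two_self, cosetMass_succ hq0, cosetTailMass]
    field_simp
    ring

lemma cosetVal_norm_eq_one {q : ℝ} (hq : 1 < q) (l : ℕ) :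
    cosetVal q l (l - 1) * cosetVal q l (l - 1) * cosetMass q (l - 1)
      + cosetVal q l l * cosetVal q l l * cosetTailMass q (l - 1) = 1 := by
  have hq0 : 0 < q := by linarith
  have hq1 : q - 1 ≠ 0 := by linarith
  rcases l with _ | _ | k
  · simp only [zero_tsub, cosetMass_zero, cosetTailMass, cosetVal, if_true]
    field_simp
  · have h2 : Real.sqrt q * Real.sqrt q = q := Real.mul_self_sqrt hq0.le
    simp only [zero_add, tsub_self, cosetVal_one_zero hq0, cosetVal_one_one, cosetMass_zero,
      cosetTailMass, ← mul_inv, neg_mul_neg, h2]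
    field_simp
    simp [add_comm]
  · rw [show k + 1 + 1 - 1 = k + 1 by omega, cosetVal_add_two_pred, cosetVal_add_two_self,
      cosetMass_succ hq0, cosetTailMass]
    calc _ = cosetScale q k ^ 2 * ((q ^ k)⁻¹ * (1 - q⁻¹) / (q + 1)
          + (q - 1) ^ 2 * ((q ^ (k + 1))⁻¹ / (q + 1))) := by ring
      _ = 1 := by
        rw [cosetScale_sq hq]
        field_simp
        ring

lemma hasSum_cosetVal_mul_of_lt {q : ℝ} (hq : 1 < q) {l l' : ℕ} (h : l' < l) :
    HasSum (fun n ↦ cosetVal q l n * cosetVal q l' n * cosetMass q n) 0 := by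
  obtain ⟨m, rfl⟩ : ∃ m, l = m + 1 := ⟨l - 1, by omega⟩
  convert hasSum_cosetVal_mul hq h.le using 1
  rw [Nat.add_sub_cancel, cosetVal_eq_self q (show l' ≤ m by omega)]
  linear_combination -cosetVal q l' l' * cosetVal_mean_eq_zero hq m

/-- orthonormality of the sequences `a(l,·)` with respect to the weights `w_n`. -/
theorem cosetVal_orthonormal (q : ℝ) (hq : 1 < q) (l l' : ℕ) :
    ∑' n : ℕ, cosetVal q l n * cosetVal q l' n * cosetMass q n
      = if l = l' then 1 else 0 := by
  rcases lt_trichotomy l l' with h | rfl | h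
  · rw [if_neg h.ne, ← (hasSum_cosetVal_mul_of_lt hq h).tsum_eq]
    simp only [mul_comm (cosetVal q l _)]
  · rw [if_pos rfl, (hasSum_cosetVal_mul hq le_rfl).tsum_eq, cosetVal_norm_eq_one hq]
  · rw [if_neg h.ne', (hasSum_cosetVal_mul_of_lt hq h).tsum_eq]
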